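/- Let O = k[[t]] and consider the symplectic situation governing the Hecke correspondence for GSp_4: let M ⊂ M' be O-lattices of rank 4 with M'/M'(-x)-notation replaced by: M ⊂ M', dim_k(M'/M) = 2, and suppose M' carries a symplectic form ∧^2 M' → A' where A' = A(x) (i.e. valuations shift by 1) such that the image of M/tM' in M'/tM' is Lagrangian. Given a rank-2 isotropic O-submodule L ⊂ M which is saturated in M, and a line bundle picture replaced by the local statement: the possible positions of L relative to M' fall into exactly three cases: (i) L saturated in M', (ii) the saturation of L in M' has colength 1 over L, (iii) the saturation has colength 2 over L — and in case (iii) the saturation equals t^{-1}L. -/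

import Mathlib

set_option synthInstance.maxHeartbeats 1000000
set_option maxHeartbeats 1600000

open PowerSeries Matrix

/-- The standard symplectic matrix for `GSp₄`. -/
noncomputable def Jmat (k : Type*) [Field k] : Matrix (Fin 4) (Fin 4) (LaurentSeries k) :=
  !![0, 0, 1, 0; 0, 0, 0, 1; -1, 0, 0, 0; 0, -1, 0, 0]

/-- The image of a linear map into a finite power of the residue field `A ⧸ m` is itself such a
power, and it has full exponent only if the map is surjective. -/
theorem exists_surjective_ker_eq_of_pi_residueField {A : Type*} [CommRing A] (m : Ideal A)
    [m.IsMaximal] {N : Type*} [AddCommGroup N] [Module A N] {n : ℕ}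
    (e : N →ₗ[A] (Fin n → A ⧸ m)) :
    ∃ r : ℕ, r ≤ n ∧ ∃ φ : N →ₗ[A] (Fin r → A ⧸ m),
      Function.Surjective φ ∧ LinearMap.ker φ = LinearMap.ker e ∧
      (r = n → Function.Surjective e) := by
  let := Ideal.Quotient.field m
  let W : Submodule (A ⧸ m) (Fin n → A ⧸ m) :=
    { carrier := Set.range e
      add_mem' := by
        rintro _ _ ⟨a, rfl⟩ ⟨b, rfl⟩
        exact ⟨a + b, map_add e a b⟩
      zero_mem' := ⟨0, map_zero e⟩
      smul_mem' := by
        rintro c _ ⟨a, rfl⟩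
        obtain ⟨c, rfl⟩ := Ideal.Quotient.mk_surjective c
        exact ⟨c • a, map_smul e c a⟩ }
  let b := Module.finBasis (A ⧸ m) W
  let f : N →ₗ[A] W := e.codRestrict (W.restrictScalars A) fun x => ⟨x, rfl⟩
  have hf : Function.Surjective f := by
    rintro ⟨_, x, rfl⟩
    exact ⟨x, rfl⟩
  refine ⟨Module.finrank (A ⧸ m) W, ?_, (b.equivFun.toLinearMap.restrictScalars A).comp f,
    b.equivFun.surjective.comp hf, ?_, ?_⟩
  · simpa using W.finrank_le
  · ext x
    have : f x = 0 ↔ e x = 0 := Subtype.ext_iff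
    simpa using this
  · intro h y
    have hW : W = ⊤ := Submodule.eq_top_of_finrank_eq (by simpa using h)
    have : y ∈ W := hW ▸ Submodule.mem_top
    exact this

/-- Local statement behind the stratification of the Hecke correspondence for
`GSp₄`.  Let `O = k[[t]]`, `F = k((t))`, `V = F⁴` with the standard symplectic
form `ω(v,w) = vᵀ J w`.  Let `M ⊆ M'` be `O`-lattices of rank 4 with
`t·M' ⊆ M` and `dim_k(M'/M) = 2` (a modification of type `γ`), with
`ω(M',M') ⊆ O` and `ω(M,M) ⊆ t·O`, so that the image of `M` in `M'/tM'` is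
Lagrangian.  Let `L ⊆ M` be an isotropic `O`-sublattice of rank 2, saturated in
`M`, and let `L^{sat}` be its saturation in `M'`.  Then the colength of `L` in
`L^{sat}` is `0`, `1` or `2`: `L^{sat}/L ≅ k^r` with `r ≤ 2`; and if `r = 2`
then `L^{sat} = t⁻¹·L`. -/
theorem isotropic_saturation_trichotomy (k : Type*) [Field k] [IsAlgClosed k]
    (h2 : (2 : k) ≠ 0)
    (M M' L Lsat : Submodule (PowerSeries k) (Fin 4 → LaurentSeries k))
    (hMM' : M ≤ M')
    (hM'lat : M'.FG ∧
      Submodule.span (LaurentSeries k) (M' : Set (Fin 4 → LaurentSeries k)) = ⊤)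
    (htM' : ∀ v ∈ M', (X : PowerSeries k) • v ∈ M)
    (hcolen : ∃ φ : ↥M' →ₗ[PowerSeries k]
        ((PowerSeries k ⧸ Ideal.span {(X : PowerSeries k)}) ×
          (PowerSeries k ⧸ Ideal.span {(X : PowerSeries k)})),
      Function.Surjective φ ∧ LinearMap.ker φ = Submodule.comap M'.subtype M)
    (hintM' : ∀ v ∈ M', ∀ w ∈ M',
      v ⬝ᵥ (Jmat k).mulVec w ∈ (algebraMap (PowerSeries k) (LaurentSeries k)).range)
    (hintM : ∀ v ∈ M, ∀ w ∈ M, ∃ c : PowerSeries k,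
      v ⬝ᵥ (Jmat k).mulVec w = algebraMap (PowerSeries k) (LaurentSeries k) (X * c))
    (hLM : L ≤ M)
    (hLrk : ∃ v₁ v₂ : Fin 4 → LaurentSeries k,
      L = Submodule.span (PowerSeries k) {v₁, v₂} ∧
      LinearIndependent (LaurentSeries k) ![v₁, v₂])
    (hLiso : ∀ v ∈ L, ∀ w ∈ L, v ⬝ᵥ (Jmat k).mulVec w = 0)
    (hLsatM : ∀ v ∈ M, (∃ c : PowerSeries k, c ≠ 0 ∧ c • v ∈ L) → v ∈ L)
    (hLsat : ∀ v, v ∈ Lsat ↔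
      (v ∈ M' ∧ ∃ c : PowerSeries k, c ≠ 0 ∧ c • v ∈ L)) :
    ∃ r : ℕ, r ≤ 2 ∧
      (∃ φ : ↥Lsat →ₗ[PowerSeries k]
          (Fin r → (PowerSeries k ⧸ Ideal.span {(X : PowerSeries k)})),
        Function.Surjective φ ∧ LinearMap.ker φ = Submodule.comap Lsat.subtype L) ∧
      (r = 2 → ∀ v : Fin 4 → LaurentSeries k,
        v ∈ Lsat ↔ (X : PowerSeries k) • v ∈ L) := by
  obtain ⟨v₁, v₂, hL, hli⟩ := hLrk
  have hX : (X : PowerSeries k) ≠ 0 := X_ne_zero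
  have : (Ideal.span {(X : PowerSeries k)}).IsMaximal :=
    PowerSeries.maximalIdeal_eq_span_X (k := k) ▸ inferInstance
  have hXV : ∀ v w : Fin 4 → LaurentSeries k,
      (X : PowerSeries k) • v = (X : PowerSeries k) • w → v = w := by
    intro v w h
    ext1 i
    have := congrFun h i
    simp only [Pi.smul_apply, Algebra.smul_def] at this
    exact mul_left_cancel₀
      ((map_ne_zero_iff _ (IsFractionRing.injective (PowerSeries k) (LaurentSeries k))).2 hX) this
  have hli' : LinearIndependent (PowerSeries k) ![v₁, v₂] :=
    hli.restrict_scalars (by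
      intro a b h
      simp only [Algebra.smul_def, mul_one] at h
      exact IsFractionRing.injective (PowerSeries k) (LaurentSeries k) h)
  have hrange : Submodule.span (PowerSeries k) (Set.range ![v₁, v₂]) = L := by
    rw [hL, Matrix.range_cons_cons_empty]
  let b : Module.Basis (Fin 2) (PowerSeries k) L :=
    (Module.Basis.span hli').map (LinearEquiv.ofEq _ _ hrange)
  have hLLsat : L ≤ Lsat := fun v hv => (hLsat v).2 ⟨hMM' (hLM hv), 1, one_ne_zero, by simpa⟩
  have hXLsat : ∀ v ∈ Lsat, (X : PowerSeries k) • v ∈ L := by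
    intro v hv
    obtain ⟨hvM, c, hc, hcv⟩ := (hLsat v).1 hv
    exact hLsatM _ (htM' v hvM) ⟨c, hc, smul_comm (X : PowerSeries k) c v ▸ L.smul_mem _ hcv⟩
  let q : L →ₗ[PowerSeries k] (Fin 2 → PowerSeries k ⧸ Ideal.span {(X : PowerSeries k)}) :=
    (LinearMap.pi fun i => (Submodule.mkQ _).comp (LinearMap.proj i)).comp b.equivFun.toLinearMap
  have hq : ∀ l : L, q l = 0 ↔ ∃ l' : L, l = (X : PowerSeries k) • l' := by
    intro l
    constructor
    · intro h
      have hdvd : ∀ i, ∃ c, b.equivFun l i = X * c := fun i =>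
        Ideal.mem_span_singleton.1 ((Submodule.Quotient.mk_eq_zero _).1 (congrFun h i))
      choose c hc using hdvd
      refine ⟨b.equivFun.symm c, b.equivFun.injective ?_⟩
      ext1 i
      rw [hc, map_smul, LinearEquiv.apply_symm_apply, Pi.smul_apply, smul_eq_mul]
    · rintro ⟨l', rfl⟩
      ext1 i
      refine (Submodule.Quotient.mk_eq_zero _).2 (Ideal.mem_span_singleton.2 ⟨b.equivFun l' i, ?_⟩)
      simp
  let μ : Lsat →ₗ[PowerSeries k] L :=
    ((LinearMap.lsmul (PowerSeries k) (Fin 4 → LaurentSeries k) X).comp Lsat.subtype).codRestrict L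
      fun v => hXLsat v v.2
  obtain ⟨r, hr, φ, hφ, hker, hsurj⟩ := exists_surjective_ker_eq_of_pi_residueField
    (Ideal.span {(X : PowerSeries k)}) (q.comp μ)
  refine ⟨r, hr, ⟨φ, hφ, ?_⟩, fun h2r v => ⟨hXLsat v, fun hv => ?_⟩⟩
  · rw [hker]
    ext v
    rw [LinearMap.mem_ker, LinearMap.comp_apply, hq, Submodule.mem_comap]
    constructor
    · rintro ⟨l', hl'⟩
      have : (v : Fin 4 → LaurentSeries k) = l' := hXV _ _ (congrArg Subtype.val hl')
      rw [Submodule.subtype_apply, this]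
      exact l'.2
    · exact fun hv => ⟨⟨v, hv⟩, rfl⟩
  · obtain ⟨w, hw⟩ := hsurj h2r (q ⟨_, hv⟩)
    obtain ⟨l, hl⟩ := (hq (⟨_, hv⟩ - μ w)).1 (by rw [map_sub, ← hw]; exact sub_self _)
    have hvw : v - w = l := hXV _ _ (by rw [smul_sub]; exact congrArg Subtype.val hl)
    rw [← sub_add_cancel v (w : Fin 4 → LaurentSeries k), hvw]
    exact Lsat.add_mem (hLLsat l.2) w.2
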